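/- Let G be a dense, K_4^3 ∪ e-free 3-graph with λ(G) > √3/18. Then G has at least 8 vertices. -/

import Mathlib

open Finset

/-- An `r`-uniform hypergraph (r-graph) with vertices drawn from `ℕ`. -/
structure HyperGraph (r : ℕ) where
  verts : Finset ℕ
  edges : Finset (Finset ℕ)
  edges_sub : ∀ e ∈ edges, e ⊆ verts
  card_eq : ∀ e ∈ edges, e.card = r

/-- A 3-uniform hypergraph (3-graph). -/
abbrev ThreeGraph := HyperGraph 3

/-- A feasible weight vector on `G`: nonnegative weights on the vertices summing to 1. -/
def HyperGraph.IsFeasible {r : ℕ} (G : HyperGraph r) (w : ℕ → ℝ) : Prop :=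
  (∀ v ∈ G.verts, 0 ≤ w v) ∧ ∑ v ∈ G.verts, w v = 1

/-- The Lagrangian function `λ(G, w) = Σ_{e ∈ E(G)} Π_{v ∈ e} w v`. -/
noncomputable def HyperGraph.lagFun {r : ℕ} (G : HyperGraph r) (w : ℕ → ℝ) : ℝ :=
  ∑ e ∈ G.edges, ∏ v ∈ e, w v

/-- The Lagrangian `λ(G)`: the maximum of `λ(G, w)` over feasible weight vectors. -/
noncomputable def HyperGraph.lag {r : ℕ} (G : HyperGraph r) : ℝ :=
  sSup {x : ℝ | ∃ w, G.IsFeasible w ∧ G.lagFun w = x}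

/-- `G` contains a copy of `F`: an injection of the vertices of `F` into those of `G`
mapping every edge of `F` to an edge of `G`. -/
def HyperGraph.ContainsCopy {r : ℕ} (G F : HyperGraph r) : Prop :=
  ∃ f : ℕ → ℕ, Set.InjOn f ↑F.verts ∧ (∀ v ∈ F.verts, f v ∈ G.verts) ∧
    ∀ e ∈ F.edges, e.image f ∈ G.edges

/-- `G` is `F`-free. -/
def HyperGraph.Free {r : ℕ} (G F : HyperGraph r) : Prop := ¬ G.ContainsCopy F

/-- `H` is a subgraph of `G`. -/
def HyperGraph.IsSubgraph {r : ℕ} (H G : HyperGraph r) : Prop :=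
  H.verts ⊆ G.verts ∧ H.edges ⊆ G.edges

/-- `G` is dense: every proper subgraph has strictly smaller Lagrangian. -/
def HyperGraph.LagDense {r : ℕ} (G : HyperGraph r) : Prop :=
  ∀ H : HyperGraph r, H.IsSubgraph G → (H.verts ≠ G.verts ∨ H.edges ≠ G.edges) →
    H.lag < G.lag

/-- The Lagrangian density `π_λ(F) = sup { r! · λ(G) : G is F-free }`. -/
noncomputable def lagDensity {r : ℕ} (F : HyperGraph r) : ℝ :=
  sSup {x : ℝ | ∃ G : HyperGraph r, G.Free F ∧ x = (Nat.factorial r : ℝ) * G.lag}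

/-- An optimum weight vector for `G`. -/
def HyperGraph.IsOptimal {r : ℕ} (G : HyperGraph r) (w : ℕ → ℝ) : Prop :=
  G.IsFeasible w ∧ G.lagFun w = G.lag

/-- `K_4^3 ∪ e`: the disjoint union of the complete 3-graph on `{1,2,3,4}`
and the single edge `{5,6,7}`. -/
def K43e : ThreeGraph where
  verts := {1, 2, 3, 4, 5, 6, 7}
  edges := {{1, 2, 3}, {1, 2, 4}, {1, 3, 4}, {2, 3, 4}, {5, 6, 7}}
  edges_sub := by decide
  card_eq := by decide

lemma aux_e3_four (d e f g : ℝ) (hd : 0 ≤ d) (he : 0 ≤ e) (hf : 0 ≤ f) (hg : 0 ≤ g) :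
    d*e*f + d*e*g + d*f*g + e*f*g ≤ (d+e+f+g)^3/16 := by
  have h1 : d*e ≤ (d+e)^2/4 := by nlinarith [sq_nonneg (d-e)]
  have h2 : f*g ≤ (f+g)^2/4 := by nlinarith [sq_nonneg (f-g)]
  have h3 := mul_le_mul_of_nonneg_right h1 (add_nonneg hf hg)
  have h4 := mul_le_mul_of_nonneg_right h2 (add_nonneg hd he)
  have h5 : (d+e)*(f+g) ≤ (d+e+f+g)^2/4 := by nlinarith [sq_nonneg (d+e-f-g)]
  have h6 := mul_le_mul_of_nonneg_right h5 (add_nonneg (add_nonneg hd he) (add_nonneg hf hg))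
  nlinarith

lemma aux_schur (a b c : ℝ) (ha : 0 ≤ a) (hb : 0 ≤ b) (hc : 0 ≤ c) :
    0 ≤ (a+b+c)^3 - 4*(a+b+c)*(a*b+a*c+b*c) + 9*(a*b*c) := by
  rcases le_total a b with h1 | h1 <;> rcases le_total b c with h2 | h2 <;>
  rcases le_total a c with h3 | h3 <;>
  nlinarith [mul_nonneg (sub_nonneg.2 h1) (sub_nonneg.2 h2),
    mul_nonneg (sub_nonneg.2 h1) (sub_nonneg.2 h3),
    mul_nonneg (sub_nonneg.2 h2) (sub_nonneg.2 h3),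
    mul_nonneg ha (mul_nonneg (sub_nonneg.2 h1) (sub_nonneg.2 h3)),
    mul_nonneg hb (mul_nonneg (sub_nonneg.2 h1) (sub_nonneg.2 h2)),
    mul_nonneg hc (mul_nonneg (sub_nonneg.2 h2) (sub_nonneg.2 h3)),
    mul_nonneg ha (sq_nonneg (b-c)), mul_nonneg hb (sq_nonneg (a-c)),
    mul_nonneg hc (sq_nonneg (a-b)), mul_nonneg ha (sq_nonneg (a-b)),
    mul_nonneg ha (sq_nonneg (a-c)), mul_nonneg hb (sq_nonneg (a-b)),
    mul_nonneg hb (sq_nonneg (b-c)), mul_nonneg hc (sq_nonneg (a-c)),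
    mul_nonneg hc (sq_nonneg (b-c)),
    mul_nonneg (sub_nonneg.2 h1) (sq_nonneg (a-b)),
    mul_nonneg (sub_nonneg.2 h2) (sq_nonneg (c-b)),
    mul_nonneg (sub_nonneg.2 h3) (sq_nonneg (a-c))]

lemma aux_cubic1 (p : ℝ) (h0 : 0 ≤ p) (h1 : p ≤ 1) :
    (1-p)^3/16 + 3/8*(1-p)^2*p + p^2/4*(1-p) ≤ 0.096 := by
  nlinarith [mul_nonneg h0 (sq_nonneg (p - 1/3)), sq_nonneg (p-1/3)]

lemma aux_cubic2 (p : ℝ) (h0 : 0 ≤ p) (h1 : p ≤ 1) :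
    (1-p)^3/16 + 3/8*(1-p)^2*p + p^2/3*(1-p) - 6*(p^3/27) ≤ 0.096 := by
  nlinarith [mul_nonneg h0 (sq_nonneg (p - 0.28)), sq_nonneg (p-0.28)]

lemma aux_ineq (a b c d e f g : ℝ) (ha : 0 ≤ a) (hb : 0 ≤ b) (hc : 0 ≤ c)
    (hd : 0 ≤ d) (he : 0 ≤ e) (hf : 0 ≤ f) (hg : 0 ≤ g) (hs : a+b+c+(d+e+f+g) = 1) :
    (d*e*f + d*e*g + d*f*g + e*f*g) + (a+b+c)*(d*e+d*f+d*g+e*f+e*g+f*g)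
      + (a*b+a*c+b*c)*(d+e+f+g) - 6*(a*b*c) ≤ 0.096 := by
  have h3 := aux_e3_four d e f g hd he hf hg
  have h2 : d*e+d*f+d*g+e*f+e*g+f*g ≤ 3/8*(d+e+f+g)^2 := by
    nlinarith [sq_nonneg (d-e), sq_nonneg (d-f), sq_nonneg (d-g), sq_nonneg (e-f),
      sq_nonneg (e-g), sq_nonneg (f-g)]
  have hsch := aux_schur a b c ha hb hc
  have hr : 0 ≤ a*b*c := by positivity
  have hp : 0 ≤ a+b+c := by positivity
  have hq : a*b+a*c+b*c ≤ (a+b+c)^2/3 := by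
    nlinarith [sq_nonneg (a-b), sq_nonneg (a-c), sq_nonneg (b-c)]
  have hS : 0 ≤ d+e+f+g := by positivity
  generalize d*e*f + d*e*g + d*f*g + e*f*g = e3 at *
  generalize d*e+d*f+d*g+e*f+e*g+f*g = e2 at *
  generalize d+e+f+g = s at *
  generalize a*b*c = r at *
  generalize a*b+a*c+b*c = q at *
  generalize a+b+c = p at *
  obtain rfl : s = 1 - p := by linarith
  have h2' := mul_le_mul_of_nonneg_left h2 hp
  have c1 := aux_cubic1 p hp (by linarith)
  have c2 := aux_cubic2 p hp (by linarith)
  rcases le_total q (p^2/4) with h | h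
  · have := mul_le_mul_of_nonneg_right h hS
    nlinarith
  · -- convex combination: `F` is bounded by a function linear in `q`
    rcases le_total 0 ((1-p) - 8/3*p) with hk | hk
    · have := mul_le_mul_of_nonneg_right hq hk
      nlinarith
    · have := mul_le_mul_of_nonpos_right h hk
      nlinarith

lemma aux_esymm7 (w : ℕ → ℝ) (S R : Finset ℕ) (hSR : Disjoint S R)
    (hS : S.card = 3) (hR : R.card = 4) (hw : ∀ v ∈ S ∪ R, 0 ≤ w v)
    (hsum : ∑ v ∈ S ∪ R, w v = 1) :
    ∑ T ∈ powersetCard 3 (S ∪ R), ∏ v ∈ T, w v - 7 * ∏ v ∈ S, w v ≤ 0.096 := by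
  obtain ⟨a, b, c, hab, hac, hbc, rfl⟩ := Finset.card_eq_three.1 hS
  obtain ⟨d, e, f, g, hde, hdf, hdg, hef, heg, hfg, rfl⟩ := Finset.card_eq_four.1 hR
  have key := aux_ineq (w a) (w b) (w c) (w d) (w e) (w f) (w g)
    (hw _ (by simp)) (hw _ (by simp)) (hw _ (by simp)) (hw _ (by simp))
    (hw _ (by simp)) (hw _ (by simp)) (hw _ (by simp))
    (by
      rw [← hsum, Finset.sum_union hSR]
      rw [Finset.sum_insert (by simp [*]), Finset.sum_insert (by simp [*]), Finset.sum_singleton,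
        Finset.sum_insert (by simp [*]), Finset.sum_insert (by simp [*]),
        Finset.sum_insert (by simp [*]), Finset.sum_singleton]
      ring)
  have hprod : ∏ v ∈ ({a, b, c} : Finset ℕ), w v = w a * w b * w c := by
    rw [Finset.prod_insert (by simp [*]), Finset.prod_insert (by simp [*]), Finset.prod_singleton]
    ring
  have hval : ({a, b, c} ∪ {d, e, f, g} : Finset ℕ).val.map w
      = w a ::ₘ w b ::ₘ w c ::ₘ w d ::ₘ w e ::ₘ w f ::ₘ w g ::ₘ 0 := by
    rw [← Finset.disjUnion_eq_union _ _ hSR, Finset.disjUnion_val]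
    rw [Finset.insert_val_of_notMem (by simp [*]), Finset.insert_val_of_notMem (by simp [*]),
      Finset.insert_val_of_notMem (by simp [*]), Finset.insert_val_of_notMem (by simp [*]),
      Finset.insert_val_of_notMem (by simp [*])]
    simp only [Finset.singleton_val, Multiset.cons_add, Multiset.singleton_add, Multiset.map_cons,
      Multiset.map_singleton]
    rfl
  have hes := Finset.esymm_map_val w ({a, b, c} ∪ {d, e, f, g}) 3
  rw [hval] at hes
  rw [← hes, hprod]
  have : (w a ::ₘ w b ::ₘ w c ::ₘ w d ::ₘ w e ::ₘ w f ::ₘ w g ::ₘ 0).esymm 3 =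
      (w d*w e*w f + w d*w e*w g + w d*w f*w g + w e*w f*w g)
      + (w a+w b+w c)*(w d*w e+w d*w f+w d*w g+w e*w f+w e*w g+w f*w g)
      + (w a*w b+w a*w c+w b*w c)*(w d+w e+w f+w g) + w a * w b * w c := by
    simp [Multiset.esymm, Multiset.powersetCard_cons, Multiset.powersetCard_one]
    ring
  rw [this]
  linarith

lemma aux_free (G : ThreeGraph) (hfree : G.Free K43e) (hcard : G.verts.card = 7)
    (T : Finset ℕ) (hT : T ∈ G.edges) :
    ∃ S ∈ powersetCard 3 (G.verts \ T), S ∉ G.edges := by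
  by_contra! hcon
  apply hfree
  have hTV := G.edges_sub T hT
  have hT3 := G.card_eq T hT
  have hR : (G.verts \ T).card = 4 := by rw [Finset.card_sdiff_of_subset hTV]; omega
  have hmem : ∀ x ∈ G.verts \ T, x ∈ G.verts ∧ x ∉ T := fun x hx => by simpa using hx
  obtain ⟨d, e, f, g, hde, hdf, hdg, hef, heg, hfg, hReq⟩ := Finset.card_eq_four.1 hR
  rw [hReq] at hcon hmem
  obtain ⟨a, b, c, hab, hac, hbc, rfl⟩ := Finset.card_eq_three.1 hT3
  have ed : ∀ x y z, x ≠ y → x ≠ z → y ≠ z → x ∈ ({d,e,f,g} : Finset ℕ) →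
      y ∈ ({d,e,f,g} : Finset ℕ) → z ∈ ({d,e,f,g} : Finset ℕ) →
      ({x,y,z} : Finset ℕ) ∈ G.edges := by
    intro x y z h1 h2 h3 hx hy hz
    apply hcon
    rw [Finset.mem_powersetCard]
    refine ⟨?_, Finset.card_eq_three.2 ⟨x, y, z, h1, h2, h3, rfl⟩⟩
    intro t ht
    simp only [Finset.mem_insert, Finset.mem_singleton] at ht
    rcases ht with rfl | rfl | rfl <;> assumption
  have md := hmem d (by simp)
  have me := hmem e (by simp)
  have mf := hmem f (by simp)
  have mg := hmem g (by simp)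
  have ma := hTV (show a ∈ ({a,b,c} : Finset ℕ) by simp)
  have mb := hTV (show b ∈ ({a,b,c} : Finset ℕ) by simp)
  have mc := hTV (show c ∈ ({a,b,c} : Finset ℕ) by simp)
  simp only [Finset.mem_insert, Finset.mem_singleton, not_or] at md me mf mg
  obtain ⟨md, da, db, dc⟩ := md
  obtain ⟨me, ea, eb, ec⟩ := me
  obtain ⟨mf, fa, fb, fc⟩ := mf
  obtain ⟨mg, ga, gb, gc⟩ := mg
  let φ : ℕ → ℕ := fun n => match n with
    | 1 => d | 2 => e | 3 => f | 4 => g | 5 => a | 6 => b | _ => c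
  refine ⟨φ, ?_, ?_, ?_⟩
  · intro x hx y hy hxy
    simp only [K43e, Finset.coe_insert, Finset.coe_singleton, Set.mem_insert_iff,
      Set.mem_singleton_iff] at hx hy
    rcases hx with rfl | rfl | rfl | rfl | rfl | rfl | rfl <;>
    rcases hy with rfl | rfl | rfl | rfl | rfl | rfl | rfl <;>
    first
    | rfl
    | (exfalso; simp only [φ] at hxy; first | exact absurd hxy ‹_› | exact absurd hxy.symm ‹_›)
  · intro v hv
    simp only [K43e, Finset.mem_insert, Finset.mem_singleton] at hv
    rcases hv with rfl | rfl | rfl | rfl | rfl | rfl | rfl <;> simp only [φ] <;> assumption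
  · intro s hs
    simp only [K43e, Finset.mem_insert, Finset.mem_singleton] at hs
    rcases hs with rfl | rfl | rfl | rfl | rfl <;>
      simp only [Finset.image_insert, Finset.image_singleton, φ]
    · exact ed _ _ _ hde hdf hef (by simp) (by simp) (by simp)
    · exact ed _ _ _ hde hdg heg (by simp) (by simp) (by simp)
    · exact ed _ _ _ hdf hdg hfg (by simp) (by simp) (by simp)
    · exact ed _ _ _ hef heg hfg (by simp) (by simp) (by simp)
    · exact hT

lemma aux_count (G : ThreeGraph) (hfree : G.Free K43e) (hcard : G.verts.card = 7) :
    7 ≤ (powersetCard 3 G.verts \ G.edges).card := by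
  have hsub : powersetCard 3 G.verts ⊆ (powersetCard 3 G.verts \ G.edges).biUnion
      (fun S => insert S (powersetCard 3 (G.verts \ S))) := by
    intro T hT
    rw [Finset.mem_biUnion]
    by_cases hTe : T ∈ G.edges
    · obtain ⟨S, hS, hSe⟩ := aux_free G hfree hcard T hTe
      rw [Finset.mem_powersetCard] at hS hT
      refine ⟨S, ?_, ?_⟩
      · rw [Finset.mem_sdiff, Finset.mem_powersetCard]
        exact ⟨⟨hS.1.trans Finset.sdiff_subset, hS.2⟩, hSe⟩
      · refine Finset.mem_insert_of_mem ?_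
        rw [Finset.mem_powersetCard]
        refine ⟨?_, hT.2⟩
        intro x hx
        refine Finset.mem_sdiff.2 ⟨hT.1 hx, fun hxS => ?_⟩
        exact (Finset.mem_sdiff.1 (hS.1 hxS)).2 hx
    · exact ⟨T, Finset.mem_sdiff.2 ⟨hT, hTe⟩, Finset.mem_insert_self _ _⟩
  have h1 := Finset.card_le_card hsub
  have h2 := Finset.card_biUnion_le_card_mul (powersetCard 3 G.verts \ G.edges)
      (fun S => insert S (powersetCard 3 (G.verts \ S))) 5 (by
    intro S hS
    rw [Finset.mem_sdiff, Finset.mem_powersetCard] at hS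
    refine (Finset.card_insert_le _ _).trans ?_
    rw [Finset.card_powersetCard, Finset.card_sdiff_of_subset hS.1.1, hcard, hS.1.2]
    decide)
  rw [Finset.card_powersetCard, hcard] at h1
  have : Nat.choose 7 3 = 35 := by decide
  omega

/-- A dense `K_4^3 ∪ e`-free 3-graph with Lagrangian greater than `√3/18` has at
least 8 vertices. -/
theorem dense_K43e_free_eight_verts (G : ThreeGraph) (hdense : G.LagDense)
    (hfree : G.Free K43e) (hlag : Real.sqrt 3 / 18 < G.lag) : 8 ≤ G.verts.card := by
  by_contra! hlt
  have hsq : (1.732 : ℝ) ≤ Real.sqrt 3 := Real.le_sqrt_of_sq_le (by norm_num)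
  have hne : {x : ℝ | ∃ w, G.IsFeasible w ∧ G.lagFun w = x}.Nonempty := by
    by_contra hemp
    rw [Set.not_nonempty_iff_eq_empty] at hemp
    rw [HyperGraph.lag, hemp, Real.sSup_empty] at hlag
    linarith
  obtain ⟨_, ⟨w0, ⟨hw0, hs0⟩, rfl⟩, hbig⟩ := exists_lt_of_lt_csSup hne hlag
  -- extend the vertex set to exactly seven vertices, with zero weights
  obtain ⟨V, hGV, hV⟩ := Infinite.exists_superset_card_eq G.verts 7 (by omega)
  let w : ℕ → ℝ := fun v => if v ∈ G.verts then w0 v else 0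
  have hw : ∀ v, 0 ≤ w v := by
    intro v
    by_cases h : v ∈ G.verts
    · simpa [w, h] using hw0 v h
    · simp [w, h]
  have hsum : ∑ v ∈ V, w v = 1 := by
    rw [← Finset.sum_subset hGV (fun x _ hx => by simp [w, hx]), ← hs0]
    exact Finset.sum_congr rfl (fun x hx => by simp [w, hx])
  have hlf : G.lagFun w0 = ∑ e ∈ G.edges, ∏ v ∈ e, w v := by
    refine Finset.sum_congr rfl (fun e he => Finset.prod_congr rfl (fun x hx => ?_))
    simp [w, G.edges_sub e he hx]
  have hEsub : G.edges ⊆ powersetCard 3 V := fun e he =>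
    Finset.mem_powersetCard.2 ⟨(G.edges_sub e he).trans hGV, G.card_eq e he⟩
  obtain ⟨S, hS, hmin⟩ := Finset.exists_min_image (powersetCard 3 V) (fun T => ∏ v ∈ T, w v)
    (Finset.powersetCard_nonempty.2 (by omega))
  have hS' := Finset.mem_powersetCard.1 hS
  have hU : S ∪ (V \ S) = V := Finset.union_sdiff_of_subset hS'.1
  have main := aux_esymm7 w S (V \ S) Finset.disjoint_sdiff hS'.2
    (by rw [Finset.card_sdiff_of_subset hS'.1]; omega) (fun v _ => hw v) (by rw [hU, hsum])
  rw [hU, ← Finset.sum_sdiff hEsub, ← hlf] at main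
  have hSnn : 0 ≤ ∏ v ∈ S, w v := Finset.prod_nonneg (fun v _ => hw v)
  have hloss : 7 * ∏ v ∈ S, w v ≤ ∑ T ∈ powersetCard 3 V \ G.edges, ∏ v ∈ T, w v := by
    by_cases h7 : G.verts.card = 7
    · have hVG : G.verts = V := Finset.eq_of_subset_of_card_le hGV (by omega)
      have hc := aux_count G hfree h7
      rw [hVG] at hc
      have h1 := Finset.card_nsmul_le_sum (powersetCard 3 V \ G.edges)
        (fun T => ∏ v ∈ T, w v) (∏ v ∈ S, w v)
        (fun T hT => hmin T (Finset.mem_sdiff.1 hT).1)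
      rw [nsmul_eq_mul] at h1
      refine le_trans (mul_le_mul_of_nonneg_right ?_ hSnn) h1
      exact_mod_cast hc
    · obtain ⟨v, hvV, hvG⟩ : ∃ v ∈ V, v ∉ G.verts := by
        by_contra! hcon
        have := Finset.card_le_card (show V ⊆ G.verts from hcon)
        omega
      obtain ⟨T, hvT, hTV, hT3⟩ := Finset.exists_subsuperset_card_eq
        (Finset.singleton_subset_iff.2 hvV) (n := 3) (by simp) (by omega)
      have h0 : ∏ x ∈ T, w x = 0 :=
        Finset.prod_eq_zero (Finset.singleton_subset_iff.1 hvT) (by simp [w, hvG])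
      have h1 := hmin T (Finset.mem_powersetCard.2 ⟨hTV, hT3⟩)
      simp only [h0] at h1
      have h2 : 0 ≤ ∑ T ∈ powersetCard 3 V \ G.edges, ∏ v ∈ T, w v :=
        Finset.sum_nonneg (fun T _ => Finset.prod_nonneg (fun v _ => hw v))
      linarith
  linarith
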